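/- Let κ > 0, ε ∈ (0,1), φ ∈ (0, π/2), λ ∈ ℝ with ε⁻¹λ² + 1 < 1/cos²(φ), and θ ∈ (−φ, φ). If (1 − ε)sin²(θ) + (1 − ε⁻¹)λ² cos²(θ) ≤ κ(cos(θ) − cos(φ)), then cos(θ) ≥ B(λ), where B(λ) = (√(κ²/(1−ε)² + 4(ε⁻¹λ² + 1)(κ cos(φ)/(1−ε) + 1)) − κ/(1−ε)) / (2(ε⁻¹λ² + 1)). -/

import Mathlib

open Real

theorem stmt_9 (κ ε φ l θ : ℝ) (hκ : 0 < κ) (hε : ε ∈ Set.Ioo (0:ℝ) 1)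
    (hφ : φ ∈ Set.Ioo 0 (π / 2)) (hl : ε⁻¹ * l ^ 2 + 1 < 1 / cos φ ^ 2)
    (hθ : θ ∈ Set.Ioo (-φ) φ)
    (h : (1 - ε) * sin θ ^ 2 + (1 - ε⁻¹) * l ^ 2 * cos θ ^ 2 ≤ κ * (cos θ - cos φ)) :
    cos θ ≥ (Real.sqrt (κ ^ 2 / (1 - ε) ^ 2 +
        4 * (ε⁻¹ * l ^ 2 + 1) * (κ * cos φ / (1 - ε) + 1)) - κ / (1 - ε)) /
        (2 * (ε⁻¹ * l ^ 2 + 1)) := by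
  obtain ⟨h0, h1⟩ := hε
  obtain ⟨hp0, hp1⟩ := hφ
  obtain ⟨ht0, ht1⟩ := hθ
  have hc : 0 < cos θ := cos_pos_of_mem_Ioo ⟨by linarith, by linarith⟩
  have he : 0 < 1 - ε := by linarith
  have hA : 0 < ε⁻¹ * l ^ 2 + 1 := by positivity
  have hk : 0 < κ / (1 - ε) := by positivity
  have e1 : κ = κ / (1 - ε) * (1 - ε) := by field_simp
  have e2 : (1 - ε⁻¹) = -(1 - ε) * ε⁻¹ := by field_simp; ring
  have e3 : κ * cos φ / (1 - ε) = κ / (1 - ε) * cos φ := by ring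
  have e4 : κ ^ 2 / (1 - ε) ^ 2 = (κ / (1 - ε)) ^ 2 := by rw [div_pow]
  rw [e3, e4]
  rw [e2, sin_sq] at h
  generalize κ / (1 - ε) = k at *
  have hq : 0 ≤ (ε⁻¹ * l ^ 2 + 1) * cos θ ^ 2 + k * cos θ - (k * cos φ + 1) := by
    subst e1
    refine nonneg_of_mul_nonneg_right (a := 1 - ε) ?_ he
    linarith
  generalize ε⁻¹ * l ^ 2 + 1 = A at *
  rw [ge_iff_le, div_le_iff₀ (by positivity), sub_le_iff_le_add]
  apply Real.sqrt_le_iff.mpr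
  refine ⟨by positivity, ?_⟩
  nlinarith [mul_nonneg hA.le hq]
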